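/- arXiv:1009.0099 — 2 statements merged into one kernel-verified Lean document; each statement's English description precedes it below -/
import Mathlib

section
/- Let H₁, H₂, H₃ be real Hilbert spaces and let Φ : H₁ × H₂ × H₃ → ℝ be twice Fréchet differentiable at a point y ∈ H₁ × H₂ × H₃. Write B_{ij} := ∂_{ij}Φ(y). Suppose that (i) ∂₁Φ(y) = ∂₂Φ(y) = ∂₃Φ(y) = 0; (ii) B₁₁ ≫ 0, B₂₂ ≫ 0, B₃₃ ≫ 0; (iii) B₂₂ − B₂₁B₁₁⁻¹B₁₂ ≫ 0, B₂₂ − B₂₃B₃₃⁻¹B₃₂ ≫ 0, B₃₃ − B₃₁B₁₁⁻¹B₁₃ ≫ 0, B₃₃ − B₃₂B₂₂⁻¹B₂₃ ≫ 0; (iv) (B₂₂ − B₂₁B₁₁⁻¹B₁₂) − (B₂₃ − B₂₁B₁₁⁻¹B₁₃)·(B₃₃ − B₃₁B₁₁⁻¹B₁₃)⁻¹·(B₃₂ − B₃₁B₁₁⁻¹B₁₂) ≫ 0 and (B₃₃ − B₃₁B₁₁⁻¹B₁₃) − (B₃₂ − B₃₁B₁₁⁻¹B₁₂)·(B₂₂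 − B₂₁B₁₁⁻¹B₁₂)⁻¹·(B₂₃ − B₂₁B₁₁⁻¹B₁₃) ≫ 0; and (v) B₁₁ − (B₁₂, B₁₃)·C⁻¹·(B₂₁, B₃₁)ᵗ ≫ 0, where C is the operator matrix (B_{ij})_{i,j=2}^3 on H₂ × H₃ (invertible by (ii)–(iii)). Then Φ has a strong local minimum at y. -/
open ContinuousLinearMap RealInnerProductSpace Filter Topology

noncomputable section

/-- A continuous linear operator `B` on a real Hilbert space is *positive definite*
(`B ≫ 0`) if there is `c > 0` with `⟪B h, h⟫ ≥ c‖h‖²` for all `h`. -/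
def IsPosDef {H : Type*} [NormedAddCommGroup H] [InnerProductSpace ℝ H]
    (B : H →L[ℝ] H) : Prop :=
  ∃ c > 0, ∀ h : H, c * ‖h‖ ^ 2 ≤ ⟪B h, h⟫

section SchurComplement

variable {E : Type*} [NormedAddCommGroup E] [InnerProductSpace ℝ E] [CompleteSpace E]

theorem IsPosDef.isUnit {A : E →L[ℝ] E} (hA : IsPosDef A) : IsUnit A := by
  obtain ⟨c, hc, h⟩ := hA
  refine ContinuousLinearMap.isUnit_of_forall_le_norm_inner_map A (c := ⟨c, hc.le⟩) hc ?_
  intro x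
  rw [mul_comm]
  exact (h x).trans (le_abs_self _)

theorem IsPosDef.apply_inverse {A : E →L[ℝ] E} (hA : IsPosDef A) (x : E) :
    A (Ring.inverse A x) = x := by
  have h := Ring.mul_inverse_cancel A hA.isUnit
  exact congrArg (fun T : E →L[ℝ] E => T x) h

theorem IsPosDef.inner_inverse_comm {A : E →L[ℝ] E} (hA : IsPosDef A)
    (hsymm : ∀ x z, ⟪A x, z⟫ = ⟪x, A z⟫) (x z : E) :
    ⟪Ring.inverse A x, z⟫ = ⟪x, Ring.inverse A z⟫ := by
  have h := hsymm (Ring.inverse A x) (Ring.inverse A z)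
  rw [hA.apply_inverse, hA.apply_inverse] at h
  exact h.symm

/-- Coercivity of a block quadratic form from positivity of a diagonal block and of its
Schur complement. -/
theorem IsPosDef.exists_coercive_of_schur {F : Type*} [NormedAddCommGroup F] [NormedSpace ℝ F]
    {A : E →L[ℝ] E} (hA : IsPosDef A) (hsymm : ∀ x z, ⟪A x, z⟫ = ⟪x, A z⟫)
    (B : F →L[ℝ] E) (q : F → ℝ)
    (hq : ∃ c > 0, ∀ f, c * ‖f‖ ^ 2 ≤ q f - ⟪Ring.inverse A (B f), B f⟫) :
    ∃ c > 0, ∀ e f, c * (‖e‖ ^ 2 + ‖f‖ ^ 2) ≤ ⟪A e, e⟫ + 2 * ⟪B f, e⟫ + q f := by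
  have hinv := hA.apply_inverse
  obtain ⟨a, ha, hA⟩ := hA
  obtain ⟨c, hc, hq⟩ := hq
  set R : F →L[ℝ] E := Ring.inverse A ∘L B with hR
  set m : ℝ := min (a / 2) (c / (2 * ‖R‖ ^ 2 + 1)) with hm
  have hM : 0 < 2 * ‖R‖ ^ 2 + 1 := by positivity
  have hm0 : 0 < m := by positivity
  have hma : 2 * m ≤ a := by linarith [min_le_left (a / 2) (c / (2 * ‖R‖ ^ 2 + 1))]
  have hmc : m * (2 * ‖R‖ ^ 2 + 1) ≤ c := (le_div_iff₀ hM).1 (min_le_right _ _)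
  refine ⟨m, hm0, fun e f => ?_⟩
  have hAR : A (R f) = B f := hinv (B f)
  have hu := hA (e + R f)
  have hexp : ⟪A (e + R f), e + R f⟫ = ⟪A e, e⟫ + 2 * ⟪B f, e⟫ + ⟪R f, B f⟫ := by
    rw [map_add, inner_add_left, inner_add_right, inner_add_right, hsymm e (R f), hAR,
      real_inner_comm (B f) e, real_inner_comm (B f) (R f)]
    ring
  have hqf : c * ‖f‖ ^ 2 ≤ q f - ⟪R f, B f⟫ := hq f
  have hnorm : ‖e‖ ≤ ‖e + R f‖ + ‖R‖ * ‖f‖ := by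
    calc ‖e‖ = ‖(e + R f) - R f‖ := by rw [add_sub_cancel_right]
      _ ≤ ‖e + R f‖ + ‖R f‖ := norm_sub_le _ _
      _ ≤ _ := by gcongr; exact R.le_opNorm f
  have hsq : ‖e‖ ^ 2 ≤ 2 * ‖e + R f‖ ^ 2 + 2 * (‖R‖ * ‖f‖) ^ 2 := by
    nlinarith [norm_nonneg e, sq_nonneg (‖e + R f‖ - ‖R‖ * ‖f‖)]
  calc m * (‖e‖ ^ 2 + ‖f‖ ^ 2)
      ≤ m * ((2 * ‖e + R f‖ ^ 2 + 2 * (‖R‖ * ‖f‖) ^ 2) + ‖f‖ ^ 2) := by gcongr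
    _ = 2 * m * ‖e + R f‖ ^ 2 + m * (2 * ‖R‖ ^ 2 + 1) * ‖f‖ ^ 2 := by ring
    _ ≤ a * ‖e + R f‖ ^ 2 + c * ‖f‖ ^ 2 := by gcongr
    _ ≤ _ := by linarith

end SchurComplement

/-- Second-order sufficient condition for a strict local minimum. -/
theorem exists_strict_min_of_coercive {E : Type*} [NormedAddCommGroup E] [NormedSpace ℝ E]
    {Φ : E → ℝ} {y : E} {Φ' : E → E →L[ℝ] ℝ} {Φ'' : E →L[ℝ] E →L[ℝ] ℝ}
    (hΦ' : ∀ᶠ x in 𝓝 y, HasFDerivAt Φ (Φ' x) x) (hΦ'' : HasFDerivAt Φ' Φ'' y)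
    (hcrit : Φ' y = 0) (hpos : ∃ c > 0, ∀ h, c * ‖h‖ ^ 2 ≤ Φ'' h h) :
    ∃ U ∈ 𝓝 y, ∀ x ∈ U, x ≠ y → Φ y < Φ x := by
  obtain ⟨c, hc, hpos⟩ := hpos
  have hlittle := hΦ''.isLittleO.def (half_pos hc)
  obtain ⟨δ, hδ, hball⟩ := Metric.eventually_nhds_iff_ball.1 (hΦ'.and hlittle)
  refine ⟨Metric.ball y δ, Metric.ball_mem_nhds y hδ, fun x hx hxy => ?_⟩
  set h : E := x - y with hh
  have hh0 : 0 < ‖h‖ := norm_pos_iff.2 (sub_ne_zero.2 hxy)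
  have hmem : ∀ t ∈ Set.Icc (0 : ℝ) 1, y + t • h ∈ Metric.ball y δ := by
    intro t ht
    rw [mem_ball_iff_norm] at hx ⊢
    rw [add_sub_cancel_left, norm_smul, Real.norm_of_nonneg ht.1]
    exact (mul_le_of_le_one_left (norm_nonneg _) ht.2).trans_lt hx
  have hderiv : ∀ t ∈ Set.Icc (0 : ℝ) 1,
      HasDerivAt (fun s : ℝ => Φ (y + s • h)) (Φ' (y + t • h) h) t := by
    intro t ht
    have hline : HasDerivAt (fun s : ℝ => y + s • h) h t := by
      simpa using ((hasDerivAt_id t).smul_const h).const_add y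
    exact (hball _ (hmem t ht)).1.comp_hasDerivAt t hline
  have hmono : StrictMonoOn (fun s : ℝ => Φ (y + s • h)) (Set.Icc 0 1) := by
    refine strictMonoOn_of_deriv_pos (convex_Icc 0 1)
      (fun t ht => (hderiv t ht).continuousAt.continuousWithinAt) fun t ht => ?_
    rw [interior_Icc] at ht
    have htI := Set.Ioo_subset_Icc_self ht
    rw [(hderiv t htI).deriv]
    have hb := (hball _ (hmem t htI)).2
    rw [hcrit, sub_zero, add_sub_cancel_left, norm_smul, Real.norm_of_nonneg ht.1.le] at hb
    have hb' := (abs_le.1 (((Φ' (y + t • h) - Φ'' (t • h)).le_opNorm h).trans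
      (mul_le_mul_of_nonneg_right hb (norm_nonneg h)))).1
    simp only [sub_apply, map_smul, smul_apply, smul_eq_mul] at hb'
    have := mul_le_mul_of_nonneg_left (hpos h) ht.1.le
    have : 0 < c / 2 * (t * ‖h‖) * ‖h‖ := by have := ht.1; positivity
    nlinarith
  simpa [hh] using hmono (Set.left_mem_Icc.2 zero_le_one) (Set.right_mem_Icc.2 zero_le_one)
    zero_lt_one

theorem statement14
    {H₁ H₂ H₃ : Type*}
    [NormedAddCommGroup H₁] [InnerProductSpace ℝ H₁] [CompleteSpace H₁]
    [NormedAddCommGroup H₂] [InnerProductSpace ℝ H₂] [CompleteSpace H₂]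
    [NormedAddCommGroup H₃] [InnerProductSpace ℝ H₃] [CompleteSpace H₃]
    (Φ : H₁ × H₂ × H₃ → ℝ) (y : H₁ × H₂ × H₃)
    -- `Φ` is twice Fréchet differentiable at `y`
    (Φ' : H₁ × H₂ × H₃ → ((H₁ × H₂ × H₃) →L[ℝ] ℝ))
    (Φ'' : (H₁ × H₂ × H₃) →L[ℝ] ((H₁ × H₂ × H₃) →L[ℝ] ℝ))
    (hΦ' : ∀ᶠ x in 𝓝 y, HasFDerivAt Φ (Φ' x) x)
    (hΦ'' : HasFDerivAt Φ' Φ'' y)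
    -- `Bᵢⱼ = ∂ᵢⱼΦ(y)` are the blocks of the second derivative
    (B₁₁ : H₁ →L[ℝ] H₁) (B₁₂ : H₂ →L[ℝ] H₁) (B₁₃ : H₃ →L[ℝ] H₁)
    (B₂₁ : H₁ →L[ℝ] H₂) (B₂₂ : H₂ →L[ℝ] H₂) (B₂₃ : H₃ →L[ℝ] H₂)
    (B₃₁ : H₁ →L[ℝ] H₃) (B₃₂ : H₂ →L[ℝ] H₃) (B₃₃ : H₃ →L[ℝ] H₃)
    (hB : ∀ (h₁ k₁ : H₁) (h₂ k₂ : H₂) (h₃ k₃ : H₃),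
        Φ'' (h₁, h₂, h₃) (k₁, k₂, k₃) =
          ⟪B₁₁ h₁ + B₁₂ h₂ + B₁₃ h₃, k₁⟫ + ⟪B₂₁ h₁ + B₂₂ h₂ + B₂₃ h₃, k₂⟫ +
            ⟪B₃₁ h₁ + B₃₂ h₂ + B₃₃ h₃, k₃⟫)
    -- (i) the partial derivatives of `Φ` vanish at `y`
    (hcrit₁ : ∀ h₁ : H₁, Φ' y (h₁, 0, 0) = 0)
    (hcrit₂ : ∀ h₂ : H₂, Φ' y (0, h₂, 0) = 0)
    (hcrit₃ : ∀ h₃ : H₃, Φ' y (0, 0, h₃) = 0)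
    -- (ii)
    (hpos₁ : IsPosDef B₁₁) (hpos₂ : IsPosDef B₂₂) (hpos₃ : IsPosDef B₃₃)
    -- (iii)
    (hs₁ : IsPosDef (B₂₂ - B₂₁ ∘L Ring.inverse B₁₁ ∘L B₁₂))
    (hs₂ : IsPosDef (B₂₂ - B₂₃ ∘L Ring.inverse B₃₃ ∘L B₃₂))
    (hs₃ : IsPosDef (B₃₃ - B₃₁ ∘L Ring.inverse B₁₁ ∘L B₁₃))
    (hs₄ : IsPosDef (B₃₃ - B₃₂ ∘L Ring.inverse B₂₂ ∘L B₂₃))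
    -- (iv)
    (hss₁ : IsPosDef ((B₂₂ - B₂₁ ∘L Ring.inverse B₁₁ ∘L B₁₂) -
      (B₂₃ - B₂₁ ∘L Ring.inverse B₁₁ ∘L B₁₃) ∘L
        Ring.inverse (B₃₃ - B₃₁ ∘L Ring.inverse B₁₁ ∘L B₁₃) ∘L
          (B₃₂ - B₃₁ ∘L Ring.inverse B₁₁ ∘L B₁₂)))
    (hss₂ : IsPosDef ((B₃₃ - B₃₁ ∘L Ring.inverse B₁₁ ∘L B₁₃) -
      (B₃₂ - B₃₁ ∘L Ring.inverse B₁₁ ∘L B₁₂) ∘L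
        Ring.inverse (B₂₂ - B₂₁ ∘L Ring.inverse B₁₁ ∘L B₁₂) ∘L
          (B₂₃ - B₂₁ ∘L Ring.inverse B₁₁ ∘L B₁₃)))
    -- (v) with `C = (Bᵢⱼ)ᵢ,ⱼ₌₂³` acting on `H₂ × H₃`
    (hv : IsPosDef (B₁₁ - (B₁₂.coprod B₁₃) ∘L
      Ring.inverse ((B₂₂.coprod B₂₃).prod (B₃₂.coprod B₃₃)) ∘L (B₂₁.prod B₃₁))) :
    -- `Φ` has a strong local minimum at `y`
    ∃ U ∈ 𝓝 y, ∀ x ∈ U, x ≠ y → Φ y < Φ x := by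
  have hsymm := second_derivative_symmetric_of_eventually hΦ' hΦ''
  have h₁₁ : ∀ x z, ⟪B₁₁ x, z⟫ = ⟪x, B₁₁ z⟫ := fun x z => by
    simpa [hB, real_inner_comm] using hsymm (x, 0, 0) (z, 0, 0)
  have h₃₃ : ∀ x z, ⟪B₃₃ x, z⟫ = ⟪x, B₃₃ z⟫ := fun x z => by
    simpa [hB, real_inner_comm] using hsymm (0, 0, x) (0, 0, z)
  have h₂₁ : ∀ x z, ⟪B₂₁ x, z⟫ = ⟪x, B₁₂ z⟫ := fun x z => by
    simpa [hB, real_inner_comm] using hsymm (x, 0, 0) (0, z, 0)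
  have h₃₁ : ∀ x z, ⟪B₃₁ x, z⟫ = ⟪x, B₁₃ z⟫ := fun x z => by
    simpa [hB, real_inner_comm] using hsymm (x, 0, 0) (0, 0, z)
  have h₁₃ : ∀ x z, ⟪x, B₃₁ z⟫ = ⟪B₁₃ x, z⟫ := fun x z => by
    rw [real_inner_comm, h₃₁, real_inner_comm]
  have h₂₃ : ∀ x z, ⟪B₂₃ x, z⟫ = ⟪x, B₃₂ z⟫ := fun x z => by
    simpa [hB, real_inner_comm] using hsymm (0, 0, x) (0, z, 0)
  have hinv := hpos₁.inner_inverse_comm h₁₁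
  set S₃₃ := B₃₃ - B₃₁ ∘L Ring.inverse B₁₁ ∘L B₁₃ with hS₃₃
  set S₃₂ := B₃₂ - B₃₁ ∘L Ring.inverse B₁₁ ∘L B₁₂ with hS₃₂
  set S₂₃ := B₂₃ - B₂₁ ∘L Ring.inverse B₁₁ ∘L B₁₃ with hS₂₃
  set S₂₂ := B₂₂ - B₂₁ ∘L Ring.inverse B₁₁ ∘L B₁₂ with hS₂₂
  have hS₃₃symm : ∀ x z, ⟪S₃₃ x, z⟫ = ⟪x, S₃₃ z⟫ := fun x z => by
    simp only [hS₃₃, sub_apply, comp_apply, inner_sub_left, inner_sub_right, h₃₃, h₃₁, h₁₃, hinv]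
  have hS₂₃adj : ∀ x z, ⟪S₂₃ x, z⟫ = ⟪x, S₃₂ z⟫ := fun x z => by
    simp only [hS₂₃, hS₃₂, sub_apply, comp_apply, inner_sub_left, inner_sub_right, h₂₃, h₂₁,
      h₁₃, hinv]
  have hred : ∃ c > 0, ∀ (h₃ : H₃) (h₂ : H₂), c * (‖h₃‖ ^ 2 + ‖h₂‖ ^ 2) ≤
      ⟪S₃₃ h₃, h₃⟫ + 2 * ⟪S₃₂ h₂, h₃⟫ + ⟪S₂₂ h₂, h₂⟫ := by
    refine hs₃.exists_coercive_of_schur hS₃₃symm S₃₂ (fun h₂ => ⟪S₂₂ h₂, h₂⟫) ?_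
    obtain ⟨c, hc, h⟩ := hss₁
    refine ⟨c, hc, fun f => (h f).trans_eq ?_⟩
    simp only [sub_apply, comp_apply, inner_sub_left, hS₂₃adj]
  have hfull : ∃ c > 0, ∀ (h₁ : H₁) (f : H₂ × H₃), c * (‖h₁‖ ^ 2 + ‖f‖ ^ 2) ≤
      ⟪B₁₁ h₁, h₁⟫ + 2 * ⟪B₁₂.coprod B₁₃ f, h₁⟫ +
        (⟪B₂₂ f.1, f.1⟫ + 2 * ⟪B₃₂ f.1, f.2⟫ + ⟪B₃₃ f.2, f.2⟫) := by
    refine hpos₁.exists_coercive_of_schur h₁₁ (B₁₂.coprod B₁₃)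
      (fun f => ⟪B₂₂ f.1, f.1⟫ + 2 * ⟪B₃₂ f.1, f.2⟫ + ⟪B₃₃ f.2, f.2⟫) ?_
    obtain ⟨c, hc, h⟩ := hred
    refine ⟨c, hc, fun f => ?_⟩
    have hsup : ‖f‖ ^ 2 ≤ ‖f.2‖ ^ 2 + ‖f.1‖ ^ 2 := by
      rw [Prod.norm_def]
      rcases max_choice ‖f.1‖ ‖f.2‖ with h | h <;> rw [h] <;> nlinarith
    refine (mul_le_mul_of_nonneg_left hsup hc.le).trans ((h f.2 f.1).trans_eq ?_)
    have hcross : ⟪Ring.inverse B₁₁ (B₁₃ f.2), B₁₂ f.1⟫ =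
        ⟪Ring.inverse B₁₁ (B₁₂ f.1), B₁₃ f.2⟫ := by rw [hinv, real_inner_comm]
    simp only [hS₂₂, hS₃₂, hS₃₃, sub_apply, comp_apply, inner_sub_left, h₂₁, h₃₁, coprod_apply,
      map_add, inner_add_left, inner_add_right, hcross]
    ring
  refine exists_strict_min_of_coercive hΦ' hΦ'' ?_ ?_
  · ext h
    · exact hcrit₁ h
    · exact hcrit₂ h
    · exact hcrit₃ h
  · obtain ⟨c, hc, h⟩ := hfull
    refine ⟨c, hc, fun ⟨k₁, k₂, k₃⟩ => ?_⟩
    have hsup : ‖(k₁, k₂, k₃)‖ ^ 2 ≤ ‖k₁‖ ^ 2 + ‖(k₂, k₃)‖ ^ 2 := by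
      rw [Prod.norm_def]
      rcases max_choice ‖k₁‖ ‖(k₂, k₃)‖ with h | h <;> simp only [h] <;> nlinarith
    refine (mul_le_mul_of_nonneg_left hsup hc.le).trans ((h k₁ (k₂, k₃)).trans_eq ?_)
    rw [hB]
    simp only [coprod_apply, inner_add_left, h₂₁, h₃₁, h₂₃]
    rw [real_inner_comm (B₁₂ k₂) k₁, real_inner_comm (B₁₃ k₃) k₁, real_inner_comm (B₃₂ k₂) k₃]
    ring
end
end

section
/- Let H₁, H₂ be real Hilbert spaces and let φ : H₁ × H₂ → ℝ be the continuous quadratic form φ(h) = ⟨Bh, h⟩ associated with a self-adjoint continuous linear operator matrix B = (B_{ij})_{i,j=1}^2 on H₁ × H₂ (B₁₁* = B₁₁, B₂₂* = B₂₂, B₁₂* = B₂₁). Then φ is positive definite on H₁ × H₂ (i.e. there exists c > 0 with φ(h) ≥ c‖h‖² for all h) if and only if B₁₁ ≫ 0, B₂₂ ≫ 0, B₁₁ − B₁₂·B₂₂⁻¹·B₂₁ ≫ 0 and B₂₂ − B₂₁·B₁₁⁻¹·B₁₂ ≫ 0. -/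
open ContinuousLinearMap RealInnerProductSpace

noncomputable section

/-- A positive definite continuous operator on a real Hilbert space is invertible. -/
theorem IsPosDef.isUnit_s18 {H : Type*} [NormedAddCommGroup H] [InnerProductSpace ℝ H]
    [CompleteSpace H] {B : H →L[ℝ] H} (hB : IsPosDef B) : IsUnit B := by
  obtain ⟨c, hc, h⟩ := hB
  refine isUnit_of_forall_le_norm_inner_map B (c := ⟨c, hc.le⟩) hc fun x => ?_
  have := h x
  rw [mul_comm] at this
  exact this.trans (le_abs_self _)

section SchurComplement

variable {H K : Type*} [NormedAddCommGroup H] [InnerProductSpace ℝ H]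
  [NormedAddCommGroup K] [InnerProductSpace ℝ K]
  {A : H →L[ℝ] H} {B : K →L[ℝ] H} {C : H →L[ℝ] K} {D : K →L[ℝ] K}

/-- Completing the square in the quadratic form of a self-adjoint operator matrix. -/
theorem inner_blocks_eq_inner_schur_add (hBC : ∀ x y, ⟪B y, x⟫ = ⟪y, C x⟫)
    (hD : ∀ y z, ⟪D y, z⟫ = ⟪y, D z⟫) (hu : IsUnit D) (x : H) (y : K) :
    ⟪A x + B y, x⟫ + ⟪C x + D y, y⟫ =
      ⟪(A - B ∘L Ring.inverse D ∘L C) x, x⟫ +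
        ⟪D (y + Ring.inverse D (C x)), y + Ring.inverse D (C x)⟫ := by
  have hT : D (Ring.inverse D (C x)) = C x :=
    congrArg (fun f : K →L[ℝ] K => f (C x)) (Ring.mul_inverse_cancel D hu)
  have h₁ : ⟪D y, Ring.inverse D (C x)⟫ = ⟪B y, x⟫ := by rw [hD, hT, hBC]
  have h₂ : ⟪B (Ring.inverse D (C x)), x⟫ = ⟪C x, Ring.inverse D (C x)⟫ := by
    rw [hBC, real_inner_comm]
  simp only [sub_apply, comp_apply, map_add, hT, inner_add_left, inner_add_right,
    inner_sub_left, h₁, h₂]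
  ring

/-- The Schur complement of a positive definite self-adjoint operator matrix is positive
definite. -/
theorem isPosDef_schur_of_blocks (hBC : ∀ x y, ⟪B y, x⟫ = ⟪y, C x⟫)
    (hD : ∀ y z, ⟪D y, z⟫ = ⟪y, D z⟫) (hu : IsUnit D)
    (h : ∃ c > 0, ∀ x y, c * (‖x‖ ^ 2 + ‖y‖ ^ 2) ≤ ⟪A x + B y, x⟫ + ⟪C x + D y, y⟫) :
    IsPosDef (A - B ∘L Ring.inverse D ∘L C) := by
  obtain ⟨c, hc, h⟩ := h
  refine ⟨c, hc, fun x => ?_⟩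
  have hx := h x (-Ring.inverse D (C x))
  rw [inner_blocks_eq_inner_schur_add hBC hD hu, neg_add_cancel, inner_zero_right,
    add_zero] at hx
  exact le_trans (by gcongr; exact le_add_of_nonneg_right (sq_nonneg _)) hx

/-- A self-adjoint operator matrix is positive definite if its lower right block and the
corresponding Schur complement are. -/
theorem blocks_of_isPosDef_schur [CompleteSpace K] (hBC : ∀ x y, ⟪B y, x⟫ = ⟪y, C x⟫)
    (hD : ∀ y z, ⟪D y, z⟫ = ⟪y, D z⟫) (hpos : IsPosDef D)
    (hS : IsPosDef (A - B ∘L Ring.inverse D ∘L C)) :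
    ∃ c > 0, ∀ x y, c * (‖x‖ ^ 2 + ‖y‖ ^ 2) ≤ ⟪A x + B y, x⟫ + ⟪C x + D y, y⟫ := by
  have hu := hpos.isUnit_s18
  obtain ⟨d, hd, hpos⟩ := hpos
  obtain ⟨s, hs, hS⟩ := hS
  set L : H →L[ℝ] K := Ring.inverse D ∘L C
  have hM : 0 < 1 + 2 * ‖L‖ ^ 2 := by positivity
  refine ⟨min (s / (1 + 2 * ‖L‖ ^ 2)) (d / 2), by positivity, fun x y => ?_⟩
  rw [inner_blocks_eq_inner_schur_add hBC hD hu]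
  have hx := hS x
  have hz := hpos (y + L x)
  have hy : ‖y‖ ^ 2 ≤ 2 * ‖y + L x‖ ^ 2 + 2 * (‖L‖ ^ 2 * ‖x‖ ^ 2) := by
    have hle : ‖y‖ ≤ ‖y + L x‖ + ‖L‖ * ‖x‖ := by
      calc ‖y‖ = ‖y + L x - L x‖ := by rw [add_sub_cancel_right]
        _ ≤ ‖y + L x‖ + ‖L x‖ := norm_sub_le _ _
        _ ≤ _ := by gcongr; exact L.le_opNorm x
    have hsq := pow_le_pow_left₀ (norm_nonneg y) hle 2
    nlinarith [sq_nonneg (‖y + L x‖ - ‖L‖ * ‖x‖)]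
  have hm : 0 < min (s / (1 + 2 * ‖L‖ ^ 2)) (d / 2) := by positivity
  have hms := min_le_left (s / (1 + 2 * ‖L‖ ^ 2)) (d / 2)
  have hmd := min_le_right (s / (1 + 2 * ‖L‖ ^ 2)) (d / 2)
  generalize min (s / (1 + 2 * ‖L‖ ^ 2)) (d / 2) = m at hm hms hmd ⊢
  rw [le_div_iff₀ hM] at hms
  calc m * (‖x‖ ^ 2 + ‖y‖ ^ 2)
      ≤ m * (‖x‖ ^ 2 + (2 * ‖y + L x‖ ^ 2 + 2 * (‖L‖ ^ 2 * ‖x‖ ^ 2))) := by gcongr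
    _ = m * (1 + 2 * ‖L‖ ^ 2) * ‖x‖ ^ 2 + 2 * m * ‖y + L x‖ ^ 2 := by ring
    _ ≤ s * ‖x‖ ^ 2 + d * ‖y + L x‖ ^ 2 := by gcongr; linarith
    _ ≤ _ := add_le_add hx hz

end SchurComplement

theorem statement18
    {H₁ H₂ : Type*}
    [NormedAddCommGroup H₁] [InnerProductSpace ℝ H₁] [CompleteSpace H₁]
    [NormedAddCommGroup H₂] [InnerProductSpace ℝ H₂] [CompleteSpace H₂]
    (B₁₁ : H₁ →L[ℝ] H₁) (B₁₂ : H₂ →L[ℝ] H₁)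
    (B₂₁ : H₁ →L[ℝ] H₂) (B₂₂ : H₂ →L[ℝ] H₂)
    (h₁₁ : adjoint B₁₁ = B₁₁) (h₂₂ : adjoint B₂₂ = B₂₂)
    (h₁₂ : adjoint B₁₂ = B₂₁)
    -- `φ` is the quadratic form `φ(h) = ⟪Bh, h⟫` associated with the operator
    -- matrix `B` on `H₁ × H₂` (with the ℓ²-product inner product)
    (φ : H₁ × H₂ → ℝ)
    (hφ : ∀ h : H₁ × H₂,
        φ h = ⟪B₁₁ h.1 + B₁₂ h.2, h.1⟫ + ⟪B₂₁ h.1 + B₂₂ h.2, h.2⟫) :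
    -- `φ` is positive definite on `H₁ × H₂` (note `‖h‖² = ‖h.1‖² + ‖h.2‖²` for the
    -- ℓ²-product norm) iff the four Schur conditions hold
    (∃ c > 0, ∀ h : H₁ × H₂, c * (‖h.1‖ ^ 2 + ‖h.2‖ ^ 2) ≤ φ h) ↔
      (IsPosDef B₁₁ ∧ IsPosDef B₂₂ ∧
        IsPosDef (B₁₁ - B₁₂ ∘L Ring.inverse B₂₂ ∘L B₂₁) ∧
        IsPosDef (B₂₂ - B₂₁ ∘L Ring.inverse B₁₁ ∘L B₁₂)) := by
  have hA : ∀ x z, ⟪B₁₁ x, z⟫ = ⟪x, B₁₁ z⟫ := fun x z => by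
    rw [← adjoint_inner_left, h₁₁]
  have hD : ∀ y z, ⟪B₂₂ y, z⟫ = ⟪y, B₂₂ z⟫ := fun y z => by
    rw [← adjoint_inner_left, h₂₂]
  have hBC : ∀ x y, ⟪B₁₂ y, x⟫ = ⟪y, B₂₁ x⟫ := fun x y => by
    rw [← h₁₂, adjoint_inner_right]
  have hCB : ∀ y x, ⟪B₂₁ x, y⟫ = ⟪x, B₁₂ y⟫ := fun y x => by
    rw [← h₁₂, adjoint_inner_left]
  simp only [hφ, Prod.forall]
  constructor
  · intro h
    have hpos₁ : IsPosDef B₁₁ := by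
      obtain ⟨c, hc, h⟩ := h
      exact ⟨c, hc, fun x => by simpa using h x 0⟩
    have hpos₂ : IsPosDef B₂₂ := by
      obtain ⟨c, hc, h⟩ := h
      exact ⟨c, hc, fun y => by simpa using h 0 y⟩
    refine ⟨hpos₁, hpos₂, isPosDef_schur_of_blocks hBC hD hpos₂.isUnit_s18 h,
      isPosDef_schur_of_blocks hCB hA hpos₁.isUnit_s18 ?_⟩
    obtain ⟨c, hc, h⟩ := h
    refine ⟨c, hc, fun y x => ?_⟩
    rw [add_comm (‖y‖ ^ 2), add_comm (B₂₂ y), add_comm (B₁₂ y), add_comm (inner ℝ _ y)]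
    exact h x y
  · rintro ⟨-, hpos₂, hS, -⟩
    exact blocks_of_isPosDef_schur hBC hD hpos₂ hS
end
end
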